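/- For every integer r ≥ 4, g(n, r) = r^{n/2 + o(n)}; precisely, for every ε > 0 there exists n₀ such that for all n ≥ n₀ one has r^{(1/2 - ε)n} ≤ g(n, r) ≤ r^{(1/2 + ε)n}. -/

import Mathlib

open Finset

/-- The number of rainbow sum-free `r`-colorings of a finite set `A` of positive
integers. -/
noncomputable def numRSF (r : ℕ) (A : Finset ℕ) : ℕ :=
  Nat.card {f : ↥A → Fin r //
    ∀ x y z : ↥A, (x : ℕ) + (y : ℕ) = (z : ℕ) →
      ¬(f x ≠ f y ∧ f x ≠ f z ∧ f y ≠ f z)}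

/-- `g(n,r)`: the maximum of `g(A,r)` over all subsets `A ⊆ [n]`. -/
noncomputable def maxRSF (n r : ℕ) : ℕ :=
  (Finset.Icc 1 n).powerset.sup (fun A => numRSF r A)

/-- A coloring of `A` in which no Schur triple is rainbow. -/
def IsRSF {r : ℕ} {A : Finset ℕ} (f : ↥A → Fin r) : Prop :=
  ∀ x y z : ↥A, (x : ℕ) + (y : ℕ) = (z : ℕ) → ¬(f x ≠ f y ∧ f x ≠ f z ∧ f y ≠ f z)

open Classical in
/-- The rainbow sum-free `r`-colorings of `A`. -/
noncomputable def rsfColorings (r : ℕ) (A : Finset ℕ) : Finset (↥A → Fin r) :=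
  univ.filter IsRSF

theorem numRSF_eq_card (r : ℕ) (A : Finset ℕ) : numRSF r A = #(rsfColorings r A) := by
  classical
  unfold numRSF rsfColorings
  rw [Nat.card_eq_fintype_card, Fintype.card_subtype]
  congr

/-- A coloring of `A` that is constant on the pairs `{x, m - x}` is determined by its values on
one element of each pair. -/
theorem card_le_of_eq_of_add_eq {r : ℕ} (hr : 0 < r) {A : Finset ℕ} {m : ℕ}
    (hA : ∀ a ∈ A, a < m) (S : Finset (↥A → Fin r))
    (hS : ∀ g ∈ S, ∀ x y : ↥A, (x : ℕ) + y = m → g x = g y) :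
    #S ≤ r ^ (m / 2 + 1) := by
  classical
  let F : (↥A → Fin r) → (Fin (m / 2 + 1) → Fin r) := fun g i =>
    if h : (i : ℕ) ∈ A then g ⟨i, h⟩ else
      if h : m - (i : ℕ) ∈ A then g ⟨m - i, h⟩ else ⟨0, hr⟩
  have key : ∀ g ∈ S, ∀ x : ↥A, ∃ i : Fin (m / 2 + 1), (i : ℕ) = min (x : ℕ) (m - x) ∧
      F g i = g x := by
    intro g hg ⟨x, hx⟩
    have hxm := hA x hx
    refine ⟨⟨min x (m - x), by omega⟩, rfl, ?_⟩
    by_cases hle : x ≤ m - x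
    · simp [F, min_eq_left hle, hx]
    · have h1 : min x (m - x) = m - x := by omega
      have h2 : m - (m - x) = x := by omega
      by_cases hc : m - x ∈ A
      · simp only [F, h1, hc, dif_pos]
        exact hS g hg _ _ (by simp only; omega)
      · simp [F, h1, hc, h2, hx]
  have hinj : Set.InjOn F (S : Set (↥A → Fin r)) := by
    intro g hg g' hg' h
    funext x
    obtain ⟨i, hi, h1⟩ := key g hg x
    obtain ⟨j, hj, h2⟩ := key g' hg' x
    have : i = j := Fin.ext (hi.trans hj.symm)
    rw [← h1, ← h2, h, this]
  calc #S = #(S.image F) := (card_image_of_injOn hinj).symm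
    _ ≤ #(univ : Finset (Fin (m / 2 + 1) → Fin r)) := card_le_card (subset_univ _)
    _ = r ^ (m / 2 + 1) := by simp

/-- Adding a new maximum `m` at most doubles the number of extensions of a coloring, unless the
coloring is constant on all the pairs summing to `m`. -/
theorem card_rsfColorings_insert_le {r : ℕ} (hr : 0 < r) {A : Finset ℕ} {m : ℕ}
    (hA : ∀ a ∈ A, a < m) :
    #(rsfColorings r (insert m A)) ≤ 2 * #(rsfColorings r A) + r ^ (m / 2 + 1) * r := by
  classical
  let res : (↥(insert m A) → Fin r) → (↥A → Fin r) := fun f x => f ⟨x, mem_insert_of_mem x.2⟩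
  let top : ↥(insert m A) := ⟨m, mem_insert_self m A⟩
  have hres : ∀ f ∈ rsfColorings r (insert m A), res f ∈ rsfColorings r A := by
    intro f hf
    simp only [rsfColorings, mem_filter, mem_univ, true_and] at hf ⊢
    exact fun x y z h => hf _ _ _ h
  have hinj : ∀ f f' : ↥(insert m A) → Fin r, res f = res f' → f top = f' top → f = f' := by
    intro f f' h h'
    funext ⟨x, hx⟩
    rcases mem_insert.1 hx with rfl | hxA
    · exact h'
    · exact congrFun h ⟨x, hxA⟩
  let mono : (↥A → Fin r) → Prop := fun g => ∀ x y : ↥A, (x : ℕ) + y = m → g x = g y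
  have hfib : ∀ g ∈ rsfColorings r A,
      #{f ∈ rsfColorings r (insert m A) | res f = g} ≤ 2 + if mono g then r else 0 := by
    intro g _
    have himg : #{f ∈ rsfColorings r (insert m A) | res f = g} =
        #(({f ∈ rsfColorings r (insert m A) | res f = g}).image fun f => f top) := by
      refine (card_image_of_injOn ?_).symm
      intro f hf f' hf' h
      simp only [coe_filter, Set.mem_ofPred_eq] at hf hf'
      exact hinj f f' (hf.2.trans hf'.2.symm) h
    rw [himg]
    by_cases hm : mono g
    · rw [if_pos hm]
      refine (card_le_card (subset_univ _)).trans ?_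
      simp
    · rw [if_neg hm]
      simp only [mono] at hm
      push Not at hm
      obtain ⟨x, y, hxy, hne⟩ := hm
      refine (card_le_card (t := {g x, g y}) ?_).trans card_le_two
      intro c hc
      obtain ⟨f, hf, rfl⟩ := mem_image.1 hc
      simp only [rsfColorings, mem_filter, mem_univ, true_and] at hf
      obtain ⟨hf, rfl⟩ := hf
      have := hf ⟨x, mem_insert_of_mem x.2⟩ ⟨y, mem_insert_of_mem y.2⟩ top hxy
      simp only [mem_insert, mem_singleton]
      by_contra! hcon
      exact this ⟨hne, hcon.1.symm, hcon.2.symm⟩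
  calc #(rsfColorings r (insert m A))
      = ∑ g ∈ rsfColorings r A, #{f ∈ rsfColorings r (insert m A) | res f = g} :=
        card_eq_sum_card_fiberwise hres
    _ ≤ ∑ g ∈ rsfColorings r A, (2 + if mono g then r else 0) := sum_le_sum hfib
    _ = 2 * #(rsfColorings r A) + #{g ∈ rsfColorings r A | mono g} * r := by
        rw [sum_add_distrib, ← sum_filter]
        simp [mul_comm]
    _ ≤ _ := by
        gcongr
        exact card_le_of_eq_of_add_eq hr hA _ fun g hg => (mem_filter.1 hg).2

theorem numRSF_le {r : ℕ} (hr : 4 ≤ r) (m : ℕ) (A : Finset ℕ) (hA : A ⊆ Icc 1 m) :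
    (numRSF r A : ℝ) ≤ (m + 1) * √r ^ (m + 4) := by
  have hs2 : (2 : ℝ) ≤ √r := Real.le_sqrt_of_sq_le (by norm_num; exact_mod_cast hr)
  have hsq : √(r : ℝ) ^ 2 = r := Real.sq_sqrt (by positivity)
  induction m generalizing A with
  | zero =>
    obtain rfl : A = ∅ := by simpa using hA
    have h1 : numRSF r ∅ ≤ 1 := by
      rw [numRSF_eq_card]
      exact (card_le_card (subset_univ _)).trans (by simp)
    have h2 : (1 : ℝ) ≤ √r ^ (0 + 4) := one_le_pow₀ (by linarith)
    have h3 : (numRSF r ∅ : ℝ) ≤ 1 := by exact_mod_cast h1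
    simpa using h3.trans h2
  | succ m ih =>
    by_cases hm : m + 1 ∈ A
    · have hlt : ∀ a ∈ A.erase (m + 1), a < m + 1 := by
        intro a ha
        have := mem_Icc.1 (hA (mem_of_mem_erase ha))
        have := ne_of_mem_erase ha
        omega
      have hB := ih (A.erase (m + 1)) fun a ha => mem_Icc.2
        ⟨(mem_Icc.1 (hA (mem_of_mem_erase ha))).1, Nat.le_of_lt_succ (hlt a ha)⟩
      have hstep := card_rsfColorings_insert_le (r := r) (by omega) hlt
      rw [insert_erase hm, ← numRSF_eq_card, ← numRSF_eq_card] at hstep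
      have hstep' : (numRSF r A : ℝ) ≤
          2 * numRSF r (A.erase (m + 1)) + (r : ℝ) ^ ((m + 1) / 2 + 1) * r := by
        exact_mod_cast hstep
      have hpow : (r : ℝ) ^ ((m + 1) / 2 + 1) * r ≤ √r ^ (m + 1 + 4) := by
        calc (r : ℝ) ^ ((m + 1) / 2 + 1) * r = √r ^ (2 * ((m + 1) / 2 + 2)) := by
              rw [pow_mul, hsq]; ring
          _ ≤ _ := pow_le_pow_right₀ (by linarith) (by omega)
      have hmul : 2 * (numRSF r (A.erase (m + 1)) : ℝ) ≤ √r * ((m + 1) * √r ^ (m + 4)) := by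
        gcongr
      calc (numRSF r A : ℝ) ≤ √r * ((m + 1) * √r ^ (m + 4)) + √r ^ (m + 1 + 4) := by linarith
        _ = _ := by push_cast; ring
    · refine (ih A fun a ha => ?_).trans ?_
      · have := mem_Icc.1 (hA ha)
        have : a ≠ m + 1 := fun h => hm (h ▸ ha)
        exact mem_Icc.2 (by omega)
      · gcongr
        · linarith
        · linarith
        · simp

theorem maxRSF_le {r : ℕ} (hr : 4 ≤ r) (n : ℕ) :
    (maxRSF n r : ℝ) ≤ (n + 1) * √r ^ (n + 4) := by
  obtain ⟨A, hA, h⟩ := exists_mem_eq_sup (Icc 1 n).powerset ⟨∅, by simp⟩ (fun A => numRSF r A)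
  rw [maxRSF, h]
  exact numRSF_le hr n A (mem_powerset.1 hA)

theorem pow_le_maxRSF (r n : ℕ) : r ^ (n - n / 2) ≤ maxRSF n r := by
  classical
  have hsub : Ioc (n / 2) n ∈ (Icc 1 n).powerset := by
    rw [mem_powerset]
    intro a ha
    rw [mem_Ioc] at ha
    exact mem_Icc.2 (by omega)
  refine le_trans (le_of_eq ?_) (le_sup (f := fun A => numRSF r A) hsub)
  rw [numRSF_eq_card, rsfColorings, filter_true_of_mem]
  · simp
  · intro f _ x y z h
    have hx := mem_Ioc.1 x.2
    have hy := mem_Ioc.1 y.2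
    have hz := mem_Ioc.1 z.2
    omega

theorem stmt_3 (r : ℕ) (hr : 4 ≤ r) (ε : ℝ) (hε : 0 < ε) :
    ∃ n₀ : ℕ, ∀ n : ℕ, n₀ ≤ n →
      (r : ℝ) ^ (((1 : ℝ) / 2 - ε) * n) ≤ (maxRSF n r : ℝ) ∧
      (maxRSF n r : ℝ) ≤ (r : ℝ) ^ (((1 : ℝ) / 2 + ε) * n) := by
  have hr4 : (4 : ℝ) ≤ r := by exact_mod_cast hr
  have hr0 : (0 : ℝ) < r := by linarith
  have hr1 : (1 : ℝ) < r := by linarith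
  have hsq : √(r : ℝ) ^ 2 = r := Real.sq_sqrt hr0.le
  have hlim : ∀ᶠ n : ℕ in Filter.atTop, ((n : ℝ) + 1) * r ^ 2 ≤ ((r : ℝ) ^ ε) ^ n := by
    have hq : 1 < (r : ℝ) ^ ε := Real.one_lt_rpow hr1 hε
    have hq' : ((r : ℝ) ^ ε)⁻¹ < 1 := inv_lt_one_of_one_lt₀ hq
    have hq0 : 0 ≤ ((r : ℝ) ^ ε)⁻¹ := by positivity
    have h := ((tendsto_self_mul_const_pow_of_lt_one hq0 hq').add
      (tendsto_pow_atTop_nhds_zero_of_lt_one hq0 hq')).mul_const ((r : ℝ) ^ 2)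
    rw [add_zero, zero_mul] at h
    filter_upwards [h.eventually_le_const one_pos] with n hn
    have hp : 0 < ((r : ℝ) ^ ε) ^ n := by positivity
    rw [inv_pow] at hn
    field_simp at hn
    linarith
  obtain ⟨n₀, hn₀⟩ := Filter.eventually_atTop.1 hlim
  refine ⟨n₀, fun n hn => ⟨?_, ?_⟩⟩
  · calc (r : ℝ) ^ (((1 : ℝ) / 2 - ε) * n) ≤ (r : ℝ) ^ ((n - n / 2 : ℕ) : ℝ) := by
          refine Real.rpow_le_rpow_of_exponent_le hr1.le ?_
          have h : (n : ℝ) ≤ 2 * ((n - n / 2 : ℕ) : ℝ) := by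
            exact_mod_cast (by omega : n ≤ 2 * (n - n / 2))
          have : 0 ≤ ε * n := by positivity
          linarith
      _ = ((r ^ (n - n / 2) : ℕ) : ℝ) := by rw [Real.rpow_natCast]; push_cast; rfl
      _ ≤ _ := by exact_mod_cast pow_le_maxRSF r n
  · calc (maxRSF n r : ℝ) ≤ (n + 1) * √r ^ (n + 4) := maxRSF_le hr n
      _ = ((n + 1) * r ^ 2) * √r ^ n := by rw [← hsq, Real.sqrt_sq (by positivity)]; ring
      _ ≤ ((r : ℝ) ^ ε) ^ n * √r ^ n := by gcongr; exact hn₀ n hn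
      _ = (r : ℝ) ^ (((1 : ℝ) / 2 + ε) * n) := by
          rw [Real.rpow_mul_natCast hr0.le, Real.rpow_add hr0, Real.sqrt_eq_rpow, mul_pow,
            mul_comm]
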